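/- arXiv:1708.08576 — 2 statements merged into one kernel-verified Lean document; each statement's English description precedes it below -/
import Mathlib

section
/- Let M ≥ 1, p ∈ (0,1)^M and p_0 ∈ (1/2,1). Then the backwards branching-like process (Z_n)_{n≥0} associated to (M, p, p_0) is positive recurrent; in particular it has a (unique) stationary distribution π, and moreover ∑_{k≥0} k π(k) < ∞. -/
open MeasureTheory ProbabilityTheory Filter Topology
open scoped ENNReal NNReal

/-- The success probability of the `j+1`-st trial: `p (j+1)` for `j < M`, and `p₀`
afterwards. -/
noncomputable def cookieSeq (M : ℕ) (p : Fin M → ℝ) (p₀ : ℝ) (j : ℕ) : ℝ :=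
  if h : j < M then p ⟨j, h⟩ else p₀

/-- `bbTrans q l m` is the transition probability `p(l,m) = P(A (l+1) = m)` of the
backwards branching-like process: the probability that in a sequence of independent
Bernoulli trials whose `j`-th trial succeeds with probability `q j` (`j` 0-indexed),
there are exactly `m` failures before the `(l+1)`-st success.  Equivalently, among the
first `m + l` trials there are exactly `l` successes and trial `m + l` is a success. -/
noncomputable def bbTrans (q : ℕ → ℝ) (l m : ℕ) : ℝ :=
  (∑ s ∈ Finset.univ.filter
      (fun s : Fin (m + l) → Bool =>
        (Finset.univ.filter fun j => s j = true).card = l),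
    ∏ j : Fin (m + l), (if s j then q (j : ℕ) else 1 - q (j : ℕ)))
    * q (m + l)

/-- `IsStationaryDist q π` : `π` is a stationary distribution of the backwards
branching-like process with transition probabilities `bbTrans q`: a probability mass
function on `ℕ` with `π m = ∑' l, π l * p(l,m)` for all `m`. -/
def IsStationaryDist (q : ℕ → ℝ) (π : ℕ → ℝ) : Prop :=
  (∀ k, 0 ≤ π k) ∧ (∑' k, π k) = 1 ∧ ∀ m, π m = ∑' l, π l * bbTrans q l m

/-- `returnProb q n` is the probability that the backwards branching-like process with
transition probabilities `bbTrans q`, started at `0`, first returns to `0` at time `n`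
(i.e. `P₀ (T₀⁺ = n)`): the sum over all paths `0, z 1, …, z (n-1), 0` with the interior
states nonzero of the product of the transition probabilities along the path. -/
noncomputable def returnProb (q : ℕ → ℝ) (n : ℕ) : ℝ :=
  if hn : n = 0 then 0
  else
    ∑' z : Fin (n - 1) → {k : ℕ // 0 < k},
      ∏ i ∈ Finset.range n,
        bbTrans q
          (if h : 1 ≤ i ∧ i ≤ n - 1 then (z ⟨i - 1, by omega⟩ : ℕ) else 0)
          (if h : 1 ≤ i + 1 ∧ i + 1 ≤ n - 1 then (z ⟨i, by omega⟩ : ℕ) else 0)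

/-- The probability of exactly `k` successes among the first `n` trials. -/
noncomputable def successProb (q : ℕ → ℝ) (n k : ℕ) : ℝ :=
  ∑ s ∈ Finset.univ.filter
      (fun s : Fin n → Bool => (Finset.univ.filter fun j => s j = true).card = k),
    ∏ j : Fin n, (if s j then q (j : ℕ) else 1 - q (j : ℕ))

lemma successProb_eq_sum_ite (q : ℕ → ℝ) (n k : ℕ) :
    successProb q n k = ∑ s : Fin n → Bool,
      if (∑ j, if s j = true then 1 else 0) = k then
        ∏ j : Fin n, (if s j then q (j : ℕ) else 1 - q (j : ℕ)) else 0 := by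
  rw [successProb, Finset.sum_filter]
  simp only [Finset.card_filter]

lemma successProb_succ_eq_sum (q : ℕ → ℝ) (n k : ℕ) :
    successProb q (n + 1) k = (∑ s : Fin n → Bool,
      if (∑ j, if s j = true then 1 else 0) + 1 = k then
        (∏ j : Fin n, (if s j then q (j : ℕ) else 1 - q (j : ℕ))) * q n else 0)
      + ∑ s : Fin n → Bool,
      if (∑ j, if s j = true then 1 else 0) = k then
        (∏ j : Fin n, (if s j then q (j : ℕ) else 1 - q (j : ℕ))) * (1 - q n) else 0 := by
  rw [successProb_eq_sum_ite,
    ← Equiv.sum_comp (Fin.snocEquiv (fun _ : Fin (n + 1) => Bool)), Fintype.sum_prod_type,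
    Fintype.sum_bool]
  simp [Fin.snocEquiv, Fin.sum_univ_castSucc, Fin.prod_univ_castSucc]

lemma successProb_succ_zero (q : ℕ → ℝ) (n : ℕ) :
    successProb q (n + 1) 0 = successProb q n 0 * (1 - q n) := by
  rw [successProb_succ_eq_sum, successProb_eq_sum_ite, Finset.sum_mul]
  simp only [ite_mul, zero_mul, Nat.succ_ne_zero, if_false, Finset.sum_const_zero, zero_add]

lemma successProb_succ_succ (q : ℕ → ℝ) (n k : ℕ) :
    successProb q (n + 1) (k + 1)
      = successProb q n k * q n + successProb q n (k + 1) * (1 - q n) := by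
  rw [successProb_succ_eq_sum, successProb_eq_sum_ite, successProb_eq_sum_ite,
    Finset.sum_mul, Finset.sum_mul]
  simp only [ite_mul, zero_mul, Nat.add_right_cancel_iff]

lemma successProb_zero_zero (q : ℕ → ℝ) : successProb q 0 0 = 1 := by
  simp [successProb]

lemma successProb_zero_succ (q : ℕ → ℝ) (k : ℕ) : successProb q 0 (k + 1) = 0 := by
  simp [successProb]

section Trials

variable {q : ℕ → ℝ}

lemma successProb_eq_zero_of_lt {n k : ℕ} (h : n < k) : successProb q n k = 0 := by
  induction n generalizing k with
  | zero =>
    obtain ⟨k, rfl⟩ := Nat.exists_eq_succ_of_ne_zero h.ne'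
    exact successProb_zero_succ q k
  | succ n ih =>
    obtain ⟨k, rfl⟩ := Nat.exists_eq_succ_of_ne_zero (Nat.ne_zero_of_lt h)
    rw [Nat.succ_eq_add_one, successProb_succ_succ, ih (by omega), ih (by omega)]
    simp

lemma successProb_nonneg (hq : ∀ j, q j ∈ Set.Ioo (0 : ℝ) 1) (n k : ℕ) :
    0 ≤ successProb q n k := by
  refine Finset.sum_nonneg fun s _ => Finset.prod_nonneg fun j _ => ?_
  split_ifs
  · exact (hq _).1.le
  · linarith [(hq j).2]

lemma successProb_pos (hq : ∀ j, q j ∈ Set.Ioo (0 : ℝ) 1) {n k : ℕ} (h : k ≤ n) :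
    0 < successProb q n k := by
  induction n generalizing k with
  | zero =>
    obtain rfl : k = 0 := by omega
    simp [successProb_zero_zero]
  | succ n ih =>
    have h1 : 0 < 1 - q n := by linarith [(hq n).2]
    cases k with
    | zero =>
      rw [successProb_succ_zero]
      exact mul_pos (ih (Nat.zero_le _)) h1
    | succ k =>
      rw [successProb_succ_succ]
      exact add_pos_of_pos_of_nonneg (mul_pos (ih (by omega)) (hq n).1)
        (mul_nonneg (successProb_nonneg hq _ _) h1.le)

lemma bbTrans_pos (hq : ∀ j, q j ∈ Set.Ioo (0 : ℝ) 1) (l m : ℕ) : 0 < bbTrans q l m :=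
  mul_pos (successProb_pos hq (Nat.le_add_left l m)) (hq _).1

lemma sum_successProb_eq_add (q : ℕ → ℝ) (n l : ℕ) :
    ∑ k ∈ Finset.range (l + 1), successProb q n k
      = ∑ k ∈ Finset.range (l + 1), successProb q (n + 1) k + successProb q n l * q n := by
  induction l with
  | zero =>
    simp only [zero_add, Finset.sum_range_one, successProb_succ_zero]
    ring
  | succ l ih =>
    rw [Finset.sum_range_succ, ih, Finset.sum_range_succ _ (l + 1), successProb_succ_succ]
    ring

lemma sum_successProb_zero (q : ℕ → ℝ) (l : ℕ) :
    ∑ k ∈ Finset.range (l + 1), successProb q 0 k = 1 := by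
  rw [Finset.sum_range_succ', successProb_zero_zero]
  simp [successProb_zero_succ]

end Trials

section Telescoping

variable {d e : ℕ → ℝ≥0∞}

lemma add_sum_range_of_eq_succ_add (h : ∀ n, d n = d (n + 1) + e n) (N : ℕ) :
    d N + ∑ n ∈ Finset.range N, e n = d 0 := by
  induction N with
  | zero => simp
  | succ N ih => rw [← ih, Finset.sum_range_succ, h N]; ring

lemma tsum_le_of_eq_succ_add (h : ∀ n, d n = d (n + 1) + e n) : ∑' n, e n ≤ d 0 := by
  rw [ENNReal.tsum_eq_iSup_nat]
  exact iSup_le fun N => (le_add_self).trans (add_sum_range_of_eq_succ_add h N).le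

lemma tsum_eq_of_eq_succ_add (h : ∀ n, d n = d (n + 1) + e n) (hd : ∑' n, d n ≠ ⊤) :
    ∑' n, e n = d 0 := by
  have h0 := ENNReal.tendsto_atTop_zero_of_tsum_ne_top hd
  have h1 := h0.add (ENNReal.tendsto_nat_tsum e)
  simp only [add_sum_range_of_eq_succ_add h, zero_add] at h1
  exact (tendsto_nhds_unique h1 tendsto_const_nhds)

lemma sum_range_eq_of_eq_succ_add (h : ∀ n, d n = d (n + 1) + e n) (N : ℕ) :
    ∑ n ∈ Finset.range N, d n = ∑ n ∈ Finset.range N, ((n : ℝ≥0∞) + 1) * e n + N * d N := by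
  induction N with
  | zero => simp
  | succ N ih =>
    rw [Finset.sum_range_succ, ih, Finset.sum_range_succ, h N]
    push_cast
    ring

lemma tsum_mul_le_of_eq_succ_add (h : ∀ n, d n = d (n + 1) + e n) :
    ∑' n : ℕ, ((n : ℝ≥0∞) + 1) * e n ≤ ∑' n, d n := by
  rw [ENNReal.tsum_eq_iSup_nat]
  refine iSup_le fun N => le_trans ?_ (ENNReal.sum_le_tsum (Finset.range N))
  rw [sum_range_eq_of_eq_succ_add h]
  exact le_self_add

end Telescoping

section Moments

variable {q : ℕ → ℝ}

/-- The probability of at most `l` successes among the first `n` trials. -/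
noncomputable def atMostProb (q : ℕ → ℝ) (l n : ℕ) : ℝ≥0∞ :=
  ∑ k ∈ Finset.range (l + 1), ENNReal.ofReal (successProb q n k)

/-- The probability that the `(l+1)`-st success occurs at trial `n` (0-indexed). -/
noncomputable def hitProb (q : ℕ → ℝ) (l n : ℕ) : ℝ≥0∞ :=
  ENNReal.ofReal (successProb q n l * q n)

lemma atMostProb_eq_ofReal (hq : ∀ j, q j ∈ Set.Ioo (0 : ℝ) 1) (l n : ℕ) :
    atMostProb q l n = ENNReal.ofReal (∑ k ∈ Finset.range (l + 1), successProb q n k) :=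
  (ENNReal.ofReal_sum_of_nonneg fun k _ => successProb_nonneg hq n k).symm

lemma atMostProb_zero (hq : ∀ j, q j ∈ Set.Ioo (0 : ℝ) 1) (l : ℕ) : atMostProb q l 0 = 1 := by
  rw [atMostProb_eq_ofReal hq, sum_successProb_zero, ENNReal.ofReal_one]

lemma atMostProb_eq_succ_add (hq : ∀ j, q j ∈ Set.Ioo (0 : ℝ) 1) (l n : ℕ) :
    atMostProb q l n = atMostProb q l (n + 1) + hitProb q l n := by
  rw [atMostProb_eq_ofReal hq, atMostProb_eq_ofReal hq, hitProb, sum_successProb_eq_add,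
    ENNReal.ofReal_add (Finset.sum_nonneg fun k _ => successProb_nonneg hq _ k)
      (mul_nonneg (successProb_nonneg hq _ _) (hq _).1.le)]

lemma atMostProb_le_one (hq : ∀ j, q j ∈ Set.Ioo (0 : ℝ) 1) (l n : ℕ) :
    atMostProb q l n ≤ 1 := by
  rw [← atMostProb_zero hq l, ← add_sum_range_of_eq_succ_add (atMostProb_eq_succ_add hq l) n]
  exact le_self_add

lemma tsum_hitProb_le_one (hq : ∀ j, q j ∈ Set.Ioo (0 : ℝ) 1) (l : ℕ) :
    ∑' n, hitProb q l n ≤ 1 :=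
  (tsum_le_of_eq_succ_add (atMostProb_eq_succ_add hq l)).trans_eq (atMostProb_zero hq l)

lemma tsum_atMostProb_mul_le (hq : ∀ j, q j ∈ Set.Ioo (0 : ℝ) 1) (l : ℕ) :
    ∑' n, atMostProb q l n * ENNReal.ofReal (q n) ≤ l + 1 := by
  calc ∑' n, atMostProb q l n * ENNReal.ofReal (q n)
      = ∑' n, ∑ k ∈ Finset.range (l + 1), hitProb q k n := by
        refine tsum_congr fun n => ?_
        rw [atMostProb, Finset.sum_mul]
        exact Finset.sum_congr rfl fun k _ =>
          (ENNReal.ofReal_mul (successProb_nonneg hq n k)).symm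
    _ = ∑ k ∈ Finset.range (l + 1), ∑' n, hitProb q k n :=
        Summable.tsum_finsetSum fun _ _ => ENNReal.summable
    _ ≤ ∑ k ∈ Finset.range (l + 1), 1 := Finset.sum_le_sum fun k _ => tsum_hitProb_le_one hq k
    _ = l + 1 := by simp

lemma tsum_atMostProb_le (hq : ∀ j, q j ∈ Set.Ioo (0 : ℝ) 1) {M : ℕ} {p₀ : ℝ}
    (hM : ∀ j, M ≤ j → q j = p₀) (l : ℕ) :
    ∑' n, atMostProb q l n ≤ ENNReal.ofReal (M + (l + 1) / p₀) := by
  have hp : 0 < p₀ := hM M le_rfl ▸ (hq M).1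
  rw [← Summable.sum_add_tsum_nat_add' (k := M) ENNReal.summable,
    ENNReal.ofReal_add (by positivity) (by positivity)]
  refine add_le_add ?_ ?_
  · calc ∑ n ∈ Finset.range M, atMostProb q l n ≤ ∑ n ∈ Finset.range M, 1 :=
          Finset.sum_le_sum fun n _ => atMostProb_le_one hq l n
      _ = ENNReal.ofReal M := by simp
  · rw [ENNReal.ofReal_div_of_pos hp, ENNReal.le_div_iff_mul_le (by simp [hp]) (by simp),
      ← ENNReal.tsum_mul_right]
    calc ∑' n, atMostProb q l (n + M) * ENNReal.ofReal p₀
        = ∑' n, atMostProb q l (n + M) * ENNReal.ofReal (q (n + M)) :=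
          tsum_congr fun n => by rw [hM _ (Nat.le_add_left _ _)]
      _ ≤ ∑' n, atMostProb q l n * ENNReal.ofReal (q n) :=
          ENNReal.tsum_comp_le_tsum_of_injective (add_left_injective M) _
      _ ≤ l + 1 := tsum_atMostProb_mul_le hq l
      _ = ENNReal.ofReal (l + 1) := by
          rw [ENNReal.ofReal_add (by positivity) one_pos.le]; simp

lemma tsum_mul_hitProb_shift (f : ℕ → ℝ≥0∞) (l : ℕ) :
    ∑' m, f (m + l) * ENNReal.ofReal (bbTrans q l m) = ∑' n, f n * hitProb q l n := by
  rw [← Summable.sum_add_tsum_nat_add' (f := fun n => f n * hitProb q l n) (k := l)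
    ENNReal.summable, Finset.sum_eq_zero, zero_add]
  · rfl
  · intro n hn
    rw [hitProb, successProb_eq_zero_of_lt (Finset.mem_range.1 hn)]
    simp

lemma tsum_bbTrans (hq : ∀ j, q j ∈ Set.Ioo (0 : ℝ) 1) {M : ℕ} {p₀ : ℝ}
    (hM : ∀ j, M ≤ j → q j = p₀) (l : ℕ) : ∑' m, ENNReal.ofReal (bbTrans q l m) = 1 := by
  have h := tsum_mul_hitProb_shift (q := q) (fun _ => 1) l
  simp only [one_mul] at h
  rw [h, tsum_eq_of_eq_succ_add (atMostProb_eq_succ_add hq l)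
    (ne_top_of_le_ne_top ENNReal.ofReal_ne_top (tsum_atMostProb_le hq hM l)), atMostProb_zero hq]

lemma tsum_nat_mul_bbTrans_le (hq : ∀ j, q j ∈ Set.Ioo (0 : ℝ) 1) {M : ℕ} {p₀ : ℝ}
    (hM : ∀ j, M ≤ j → q j = p₀) (l : ℕ) :
    ∑' m : ℕ, (m : ℝ≥0∞) * ENNReal.ofReal (bbTrans q l m)
      ≤ ENNReal.ofReal ((1 / p₀ - 1) * l + (M + (1 / p₀ - 1))) := by
  have hp : 0 < p₀ := hM M le_rfl ▸ (hq M).1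
  have hr : 0 < 1 / p₀ - 1 := by
    have : 1 < 1 / p₀ := one_lt_one_div hp (hM M le_rfl ▸ (hq M).2)
    linarith
  have key : ∑' m : ℕ, (m : ℝ≥0∞) * ENNReal.ofReal (bbTrans q l m) + (l + 1)
      ≤ ENNReal.ofReal (M + (l + 1) / p₀) := by
    have h := tsum_mul_hitProb_shift (q := q) (fun n => (n : ℝ≥0∞) + 1) l
    have h2 := h.trans_le ((tsum_mul_le_of_eq_succ_add (atMostProb_eq_succ_add hq l)).trans
      (tsum_atMostProb_le hq hM l))
    refine le_trans (le_of_eq ?_) h2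
    simp only [Nat.cast_add, add_assoc, add_mul _ ((l : ℝ≥0∞) + 1)]
    rw [ENNReal.tsum_add, ENNReal.tsum_mul_left, tsum_bbTrans hq hM, mul_one]
  have hl : ((l : ℝ≥0∞) + 1) = ENNReal.ofReal (l + 1) := by
    rw [ENNReal.ofReal_add (by positivity) one_pos.le]; simp
  have heq : (M + (l + 1) / p₀ : ℝ) = ((1 / p₀ - 1) * l + (M + (1 / p₀ - 1))) + (l + 1) := by
    field_simp
    ring
  rw [hl, heq, ENNReal.ofReal_add (q := (l : ℝ) + 1) (by positivity) (by positivity)] at key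
  exact (ENNReal.add_le_add_iff_right ENNReal.ofReal_ne_top).1 key

end Moments

section Chain

variable {P : ℕ → ℕ → ℝ≥0∞}

/-- `tabooProb P n m` is the probability that the chain with transition probabilities `P`
started at `0` is at `m` at time `n` and has not returned to `0` during the times `1, …, n`. -/
noncomputable def tabooProb (P : ℕ → ℕ → ℝ≥0∞) : ℕ → ℕ → ℝ≥0∞
  | 0, m => if m = 0 then 1 else 0
  | n + 1, m => if m = 0 then 0 else ∑' l, tabooProb P n l * P l m

/-- The expected number of visits to `m` before the first return to `0`. -/
noncomputable def excursionMeasure (P : ℕ → ℕ → ℝ≥0∞) (m : ℕ) : ℝ≥0∞ :=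
  ∑' n, tabooProb P n m

lemma tsum_ite_zero_add (f : ℕ → ℝ≥0∞) :
    ∑' m, f m = (∑' m, if m = 0 then 0 else f m) + f 0 := by
  rw [tsum_eq_zero_add' ENNReal.summable,
    tsum_eq_zero_add' (f := fun m => if m = 0 then 0 else f m) ENNReal.summable]
  simp [add_comm]

lemma tsum_tabooProb_succ_mul (P : ℕ → ℕ → ℝ≥0∞) (n : ℕ) (h : ℕ → ℝ≥0∞) :
    ∑' m, tabooProb P (n + 1) m * h m
      = ∑' l, tabooProb P n l * ∑' m, if m = 0 then 0 else P l m * h m := by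
  simp_rw [← ENNReal.tsum_mul_left]
  rw [ENNReal.tsum_comm]
  refine tsum_congr fun m => ?_
  by_cases hm : m = 0
  · simp [tabooProb, hm]
  · simp [tabooProb, hm, ← ENNReal.tsum_mul_right, mul_assoc]

lemma tsum_tabooProb_zero_mul (P : ℕ → ℕ → ℝ≥0∞) (h : ℕ → ℝ≥0∞) :
    ∑' m, tabooProb P 0 m * h m = h 0 := by
  rw [tsum_eq_single 0 (by intro m hm; simp [tabooProb, hm])]
  simp [tabooProb]

lemma tsum_tabooProb_eq_succ_add (hP : ∀ l, ∑' m, P l m = 1) (n : ℕ) :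
    ∑' m, tabooProb P n m
      = ∑' m, tabooProb P (n + 1) m + ∑' l, tabooProb P n l * P l 0 := by
  have h := tsum_tabooProb_succ_mul P n (fun _ => 1)
  simp only [mul_one] at h
  rw [h, ← ENNReal.tsum_add]
  refine tsum_congr fun l => ?_
  rw [← mul_add, ← tsum_ite_zero_add, hP, mul_one]

/-- A Foster-Lyapunov bound for the expected cost of an excursion. -/
lemma tsum_excursionMeasure_mul_le {U c : ℕ → ℝ≥0∞}
    (hU : ∀ x, c x + ∑' z, (if z = 0 then 0 else P x z * U z) ≤ U x) :
    ∑' m, excursionMeasure P m * c m ≤ U 0 := by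
  simp_rw [excursionMeasure, ← ENNReal.tsum_mul_right]
  rw [ENNReal.tsum_comm, ENNReal.tsum_eq_iSup_nat]
  have key : ∀ N, ∑ n ∈ Finset.range N, ∑' m, tabooProb P n m * c m
      + ∑' m, tabooProb P N m * U m ≤ U 0 := by
    intro N
    induction N with
    | zero => simp [tsum_tabooProb_zero_mul]
    | succ N ih =>
      refine le_trans ?_ ih
      rw [Finset.sum_range_succ, add_assoc, tsum_tabooProb_succ_mul, ← ENNReal.tsum_add]
      simp_rw [← mul_add]
      gcongr
      exact hU _
  exact iSup_le fun N => le_self_add.trans (key N)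

lemma excursionMeasure_zero (P : ℕ → ℕ → ℝ≥0∞) : excursionMeasure P 0 = 1 := by
  rw [excursionMeasure, tsum_eq_zero_add' ENNReal.summable]
  simp [tabooProb]

lemma excursionMeasure_invariant
    (h0 : ∑' n, ∑' l, tabooProb P n l * P l 0 = 1) (m : ℕ) :
    excursionMeasure P m = ∑' l, excursionMeasure P l * P l m := by
  simp_rw [excursionMeasure, ← ENNReal.tsum_mul_right]
  rw [ENNReal.tsum_comm]
  by_cases hm : m = 0
  · subst hm
    rw [h0]
    exact excursionMeasure_zero P
  · rw [tsum_eq_zero_add' ENNReal.summable]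
    simp [tabooProb, hm]

lemma eq_of_le_of_tsum_eq {f g : ℕ → ℝ≥0∞} (hf : ∑' i, f i ≠ ⊤) (hle : ∀ i, f i ≤ g i)
    (h : ∑' i, f i = ∑' i, g i) : f = g := by
  funext i
  by_contra hne
  exact (ENNReal.tsum_lt_tsum hf hle (lt_of_le_of_ne (hle i) hne)).ne h

/-- A positive stochastic kernel has at most one invariant probability. -/
lemma invariant_unique (hP : ∀ l, ∑' m, P l m = 1) (hpos : ∀ l m, P l m ≠ 0)
    {ρ σ : ℕ → ℝ≥0∞} (hρ1 : ∑' m, ρ m = 1) (hσ1 : ∑' m, σ m = 1)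
    (hρ : ∀ m, ρ m = ∑' l, ρ l * P l m) (hσ : ∀ m, σ m = ∑' l, σ l * P l m) : ρ = σ := by
  set η : ℕ → ℝ≥0∞ := fun m => min (ρ m) (σ m) with hη
  have hmass : ∀ f : ℕ → ℝ≥0∞, ∑' m, ∑' l, f l * P l m = ∑' l, f l := fun f => by
    rw [ENNReal.tsum_comm]
    simp_rw [ENNReal.tsum_mul_left, hP, mul_one]
  have hηρ : ∀ m, η m ≤ ρ m := fun m => min_le_left _ _
  have hησ : ∀ m, η m ≤ σ m := fun m => min_le_right _ _
  have hηfin : ∑' m, η m ≠ ⊤ :=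
    ne_top_of_le_ne_top ENNReal.one_ne_top (hρ1 ▸ ENNReal.tsum_le_tsum hηρ)
  have hηinv : (fun m => ∑' l, η l * P l m) = η := by
    refine eq_of_le_of_tsum_eq (by rwa [hmass]) (fun m => le_min ?_ ?_) (hmass η)
    · rw [hρ m]
      exact ENNReal.tsum_le_tsum fun l => mul_le_mul_left (hηρ l) _
    · rw [hσ m]
      exact ENNReal.tsum_le_tsum fun l => mul_le_mul_left (hησ l) _
  have key : ∀ τ : ℕ → ℝ≥0∞, (∀ m, τ m = ∑' l, τ l * P l m) →
      (∀ m, η m ≤ τ m) → η 0 = τ 0 → η = τ := by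
    intro τ hτ hle h0
    have hη0 : η 0 ≠ ⊤ := ENNReal.ne_top_of_tsum_ne_top hηfin 0
    have hsum : η 0 + ∑' l, (τ l - η l) * P l 0 = η 0 + 0 := by
      rw [add_zero]
      conv_rhs => rw [h0, hτ 0]
      conv_lhs => rw [← congrFun hηinv 0]
      rw [← ENNReal.tsum_add]
      exact tsum_congr fun l => by rw [← add_mul, add_tsub_cancel_of_le (hle l)]
    have hz := (ENNReal.add_right_inj hη0).1 hsum
    rw [ENNReal.tsum_eq_zero] at hz
    funext l
    refine le_antisymm (hle l) (tsub_eq_zero_iff_le.1 ?_)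
    exact (mul_eq_zero.1 (hz l)).resolve_right (hpos l 0)
  rcases le_total (ρ 0) (σ 0) with h | h
  · have h1 := key ρ hρ hηρ (min_eq_left h)
    rw [← h1]
    exact eq_of_le_of_tsum_eq hηfin hησ (by rw [h1, hρ1, hσ1])
  · have h1 := key σ hσ hησ (min_eq_right h)
    rw [← h1]
    exact (eq_of_le_of_tsum_eq hηfin hηρ (by rw [h1, hρ1, hσ1])).symm

/-- The path `0, z 0, …, z (n-1), 0, 0, …`. -/
def excursionPath {n : ℕ} (z : Fin n → {k : ℕ // 0 < k}) (i : ℕ) : ℕ :=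
  if h : 1 ≤ i ∧ i ≤ n then (z ⟨i - 1, by omega⟩ : ℕ) else 0

lemma excursionPath_snoc_of_le {n : ℕ} (z : Fin n → {k : ℕ // 0 < k}) (x : {k : ℕ // 0 < k})
    {i : ℕ} (hi : i ≤ n) :
    excursionPath (Fin.snocEquiv (fun _ => {k : ℕ // 0 < k}) (x, z)) i = excursionPath z i := by
  unfold excursionPath
  by_cases h : 1 ≤ i
  · rw [dif_pos ⟨h, by omega⟩, dif_pos ⟨h, hi⟩]
    simp [Fin.snocEquiv, Fin.snoc, show i - 1 < n by omega]
  · rw [dif_neg (by omega), dif_neg (by omega)]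

lemma excursionPath_snoc_last {n : ℕ} (z : Fin n → {k : ℕ // 0 < k}) (x : {k : ℕ // 0 < k}) :
    excursionPath (Fin.snocEquiv (fun _ => {k : ℕ // 0 < k}) (x, z)) (n + 1) = x := by
  simp [excursionPath, Fin.snocEquiv, Fin.snoc]

lemma tsum_excursionPath (P : ℕ → ℕ → ℝ≥0∞) (n : ℕ) (h : ℕ → ℝ≥0∞) :
    ∑' z : Fin n → {k : ℕ // 0 < k},
        (∏ i ∈ Finset.range n, P (excursionPath z i) (excursionPath z (i + 1)))
          * h (excursionPath z n) = ∑' l, tabooProb P n l * h l := by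
  induction n generalizing h with
  | zero => rw [tsum_tabooProb_zero_mul, tsum_fintype]; simp [excursionPath]
  | succ n ih =>
    rw [← Equiv.tsum_eq (Fin.snocEquiv (fun _ => {k : ℕ // 0 < k})), ENNReal.tsum_prod']
    have hx : ∀ x : {k : ℕ // 0 < k}, ∑' z : Fin n → {k : ℕ // 0 < k},
        (∏ i ∈ Finset.range (n + 1),
          P (excursionPath (Fin.snocEquiv (fun _ => {k : ℕ // 0 < k}) (x, z)) i)
            (excursionPath (Fin.snocEquiv (fun _ => {k : ℕ // 0 < k}) (x, z)) (i + 1)))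
          * h (excursionPath (Fin.snocEquiv (fun _ => {k : ℕ // 0 < k}) (x, z)) (n + 1))
        = tabooProb P (n + 1) x * h x := by
      intro x
      have := ih (fun l => P l x * h x)
      simp only [tabooProb, x.2.ne', if_false]
      rw [← ENNReal.tsum_mul_right]
      simp only [mul_assoc]
      rw [← this]
      refine tsum_congr fun z => ?_
      rw [Finset.prod_range_succ, excursionPath_snoc_last, excursionPath_snoc_of_le z x le_rfl,
        mul_assoc]
      congr 1
      refine Finset.prod_congr rfl fun i hi => ?_
      have := Finset.mem_range.1 hi
      rw [excursionPath_snoc_of_le z x (by omega), excursionPath_snoc_of_le z x (by omega)]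
    refine (tsum_congr hx).trans ?_
    refine (tsum_subtype {k : ℕ | 0 < k} fun m => tabooProb P (n + 1) m * h m).trans ?_
    refine tsum_congr fun m => ?_
    by_cases hm : m = 0
    · simp [hm, tabooProb]
    · exact Set.indicator_of_mem (s := {k : ℕ | 0 < k}) (Nat.pos_of_ne_zero hm) _

lemma returnProb_succ {q : ℕ → ℝ} (hq : ∀ l m, 0 ≤ bbTrans q l m) (n : ℕ) :
    returnProb q (n + 1) = (∑' l, tabooProb (fun l m => ENNReal.ofReal (bbTrans q l m)) n l
      * ENNReal.ofReal (bbTrans q l 0)).toReal := by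
  rw [← tsum_excursionPath _ n fun l => ENNReal.ofReal (bbTrans q l 0), ENNReal.tsum_toReal_eq]
  · rw [returnProb, dif_neg n.succ_ne_zero]
    refine tsum_congr fun z => ?_
    rw [Finset.prod_range_succ, ENNReal.toReal_mul, ENNReal.toReal_prod]
    simp only [ENNReal.toReal_ofReal (hq _ _)]
    congr 2
    exact dif_neg (by omega)
  · intro z
    exact ENNReal.mul_ne_top (ENNReal.prod_ne_top fun _ _ => ENNReal.ofReal_ne_top)
      ENNReal.ofReal_ne_top

end Chain

section Lyapunov

variable {P : ℕ → ℕ → ℝ≥0∞}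

lemma exists_lyapunov (hP : ∀ l, ∑' m, P l m = 1) (hpos : ∀ l, P l 0 ≠ 0) {r C : ℝ}
    (hr0 : 0 ≤ r) (hr : r < 1) (hC : 0 ≤ C)
    (hdrift : ∀ l : ℕ, ∑' m : ℕ, (m : ℝ≥0∞) * P l m ≤ ENNReal.ofReal (r * l + C)) :
    ∃ U : ℕ → ℝ≥0∞, U 0 ≠ ⊤ ∧
      ∀ x : ℕ, ((x : ℝ≥0∞) + 1) + ∑' z, (if z = 0 then 0 else P x z * U z) ≤ U x := by
  have hfin : ∀ x, P x 0 ≠ ⊤ := fun x =>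
    ENNReal.ne_top_of_tsum_ne_top (by rw [hP]; exact ENNReal.one_ne_top) 0
  set a : ℕ → ℝ := fun x => (P x 0).toReal with ha
  have ha0 : ∀ x, 0 < a x := fun x => ENNReal.toReal_pos (hpos x) (hfin x)
  have hPa : ∀ x, P x 0 = ENNReal.ofReal (a x) := fun x => (ENNReal.ofReal_toReal (hfin x)).symm
  have h1r : 0 < 1 - r := by linarith
  set A : ℝ := 2 / (1 - r) with hA
  have hA0 : 0 ≤ A := by positivity
  have hAr : A * (1 - r) = 2 := div_mul_cancel₀ _ h1r.ne'
  set D : ℝ := 1 + A * C with hD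
  have hD0 : 0 ≤ D := by positivity
  obtain ⟨K, hK⟩ := exists_nat_ge D
  set B : ℝ := D * ∑ x ∈ Finset.range K, 1 / a x with hB
  have hB0 : 0 ≤ B :=
    mul_nonneg hD0 (Finset.sum_nonneg fun x _ => (one_div_pos.2 (ha0 x)).le)
  have hkey : ∀ x : ℕ, D ≤ x + B * a x := by
    intro x
    rcases lt_or_ge x K with hx | hx
    · have h1 : 1 / a x ≤ ∑ x ∈ Finset.range K, 1 / a x :=
        Finset.single_le_sum (f := fun x => 1 / a x)
          (fun x _ => (one_div_pos.2 (ha0 x)).le) (Finset.mem_range.2 hx)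
      have h2 : 1 ≤ (∑ x ∈ Finset.range K, 1 / a x) * a x :=
        (div_le_iff₀ (ha0 x)).1 h1
      have h3 : D ≤ B * a x := by rw [hB, mul_assoc]; exact le_mul_of_one_le_right hD0 h2
      have : (0 : ℝ) ≤ x := Nat.cast_nonneg x
      linarith
    · have h1 : (K : ℝ) ≤ x := Nat.cast_le.2 hx
      have h2 : 0 ≤ B * a x := mul_nonneg hB0 (ha0 x).le
      linarith
  refine ⟨fun z => ENNReal.ofReal (A * z + B), ENNReal.ofReal_ne_top, fun x => ?_⟩
  have hU : ∀ z : ℕ, ENNReal.ofReal (A * z + B)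
      = ENNReal.ofReal A * z + ENNReal.ofReal B := fun z => by
    rw [ENNReal.ofReal_add (by positivity) hB0, ENNReal.ofReal_mul hA0, ENNReal.ofReal_natCast]
  have hsum : (∑' z : ℕ, (if z = 0 then 0 else P x z * ENNReal.ofReal (A * z + B)))
      + P x 0 * ENNReal.ofReal B
      = ENNReal.ofReal A * ∑' z : ℕ, (z : ℝ≥0∞) * P x z + ENNReal.ofReal B := by
    have h := tsum_ite_zero_add fun z : ℕ => P x z * ENNReal.ofReal (A * z + B)
    simp only [Nat.cast_zero, mul_zero, zero_add] at h
    rw [← h, ← ENNReal.tsum_mul_left]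
    simp only [hU, mul_add]
    rw [ENNReal.tsum_add, ENNReal.tsum_mul_right (a := ENNReal.ofReal B), hP, one_mul]
    congr 1
    exact tsum_congr fun z => by ring
  have hfinB : P x 0 * ENNReal.ofReal B ≠ ⊤ := ENNReal.mul_ne_top (hfin x) ENNReal.ofReal_ne_top
  rw [← ENNReal.add_le_add_iff_right hfinB, add_assoc, hsum]
  have hx1 : ((x : ℝ≥0∞) + 1) = ENNReal.ofReal (x + 1) := by
    rw [ENNReal.ofReal_add (Nat.cast_nonneg x) zero_le_one, ENNReal.ofReal_natCast,
      ENNReal.ofReal_one]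
  calc (x : ℝ≥0∞) + 1 + (ENNReal.ofReal A * ∑' z : ℕ, (z : ℝ≥0∞) * P x z + ENNReal.ofReal B)
      ≤ ENNReal.ofReal (x + 1) + (ENNReal.ofReal A * ENNReal.ofReal (r * x + C)
          + ENNReal.ofReal B) := by
        rw [hx1]
        gcongr
        exact hdrift x
    _ = ENNReal.ofReal ((x + 1) + (A * (r * x + C) + B)) := by
        rw [← ENNReal.ofReal_mul hA0, ← ENNReal.ofReal_add (by positivity) hB0,
          ← ENNReal.ofReal_add (by positivity) (by positivity)]
    _ ≤ ENNReal.ofReal ((A * x + B) + a x * B) := by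
        apply ENNReal.ofReal_le_ofReal
        have h1 := hkey x
        have h2 : A * (r * x) = A * x - 2 * x := by linear_combination (-(x : ℝ)) * hAr
        rw [mul_add, h2]
        linarith
    _ = ENNReal.ofReal (A * x + B) + P x 0 * ENNReal.ofReal B := by
        rw [ENNReal.ofReal_add (by positivity) (mul_nonneg (ha0 x).le hB0),
          ENNReal.ofReal_mul (ha0 x).le, hPa]

end Lyapunov

section Stationary

variable {q : ℕ → ℝ}

lemma IsStationaryDist.tsum_ofReal {π : ℕ → ℝ} (h : IsStationaryDist q π) :
    ∑' m, ENNReal.ofReal (π m) = 1 := by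
  have hs : Summable π := by
    by_contra hs
    exact zero_ne_one ((tsum_eq_zero_of_not_summable hs).symm.trans h.2.1)
  rw [← ENNReal.ofReal_tsum_of_nonneg h.1 hs, h.2.1, ENNReal.ofReal_one]

lemma IsStationaryDist.ofReal_eq_tsum (hq : ∀ l m, 0 ≤ bbTrans q l m)
    (hP : ∀ l, ∑' m, ENNReal.ofReal (bbTrans q l m) = 1) {π : ℕ → ℝ}
    (h : IsStationaryDist q π) (m : ℕ) :
    ENNReal.ofReal (π m) = ∑' l, ENNReal.ofReal (π l) * ENNReal.ofReal (bbTrans q l m) := by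
  have hfin : ∑' l, ENNReal.ofReal (π l) * ENNReal.ofReal (bbTrans q l m) ≠ ⊤ := by
    refine ne_top_of_le_ne_top ENNReal.one_ne_top (le_trans ?_ h.tsum_ofReal.le)
    exact ENNReal.tsum_le_tsum fun l =>
      mul_le_of_le_one_right zero_le (hP l ▸ ENNReal.le_tsum m)
  rw [← ENNReal.ofReal_toReal hfin, ENNReal.tsum_toReal_eq, h.2.2 m]
  · congr 1
    refine tsum_congr fun l => ?_
    rw [ENNReal.toReal_mul, ENNReal.toReal_ofReal (h.1 l), ENNReal.toReal_ofReal (hq l m)]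
  · exact fun l => ENNReal.mul_ne_top ENNReal.ofReal_ne_top ENNReal.ofReal_ne_top

lemma isStationaryDist_toReal (hq : ∀ l m, 0 ≤ bbTrans q l m) {ρ : ℕ → ℝ≥0∞}
    (h1 : ∑' m, ρ m = 1) (h : ∀ m, ρ m = ∑' l, ρ l * ENNReal.ofReal (bbTrans q l m)) :
    IsStationaryDist q fun m => (ρ m).toReal := by
  have hfin : ∀ m, ρ m ≠ ⊤ :=
    ENNReal.ne_top_of_tsum_ne_top (by rw [h1]; exact ENNReal.one_ne_top)
  refine ⟨fun k => ENNReal.toReal_nonneg, ?_, fun m => ?_⟩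
  · rw [← ENNReal.tsum_toReal_eq hfin, h1, ENNReal.toReal_one]
  · change (ρ m).toReal = _
    rw [h m, ENNReal.tsum_toReal_eq fun l => ENNReal.mul_ne_top (hfin l) ENNReal.ofReal_ne_top]
    exact tsum_congr fun l => by rw [ENNReal.toReal_mul, ENNReal.toReal_ofReal (hq l m)]

end Stationary

lemma cookieSeq_mem_Ioo {M : ℕ} {p : Fin M → ℝ} (hp : ∀ i, p i ∈ Set.Ioo (0 : ℝ) 1)
    {p₀ : ℝ} (hp₀ : p₀ ∈ Set.Ioo (0 : ℝ) 1) (j : ℕ) :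
    cookieSeq M p p₀ j ∈ Set.Ioo (0 : ℝ) 1 := by
  unfold cookieSeq
  split_ifs
  exacts [hp _, hp₀]

/-- **Positive recurrence of the backwards branching-like process for `p₀ > 1/2`.**
For `M ≥ 1`, `p ∈ (0,1)^M` and `p₀ ∈ (1/2,1)`, the backwards branching-like process
associated to `(M, p, p₀)` is positive recurrent (started at `0` it returns to `0` with
probability one and with finite expected return time); in particular it has a unique
stationary distribution `π`, and moreover `∑ k, k * π k < ∞`. -/
theorem bb_positive_recurrent
    (M : ℕ) (hM : 1 ≤ M) (p : Fin M → ℝ) (hp : ∀ i, p i ∈ Set.Ioo (0 : ℝ) 1)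
    (p₀ : ℝ) (hp₀ : p₀ ∈ Set.Ioo (1 / 2 : ℝ) 1) :
    ((∑' n : ℕ, returnProb (cookieSeq M p p₀) n) = 1
        ∧ Summable fun n : ℕ => (n : ℝ) * returnProb (cookieSeq M p p₀) n)
    ∧ (∃! π : ℕ → ℝ, IsStationaryDist (cookieSeq M p p₀) π)
    ∧ ∀ π : ℕ → ℝ, IsStationaryDist (cookieSeq M p p₀) π →
        Summable fun k : ℕ => (k : ℝ) * π k := by
  have hp₀' : p₀ ∈ Set.Ioo (0 : ℝ) 1 := ⟨by linarith [hp₀.1], hp₀.2⟩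
  have hqM : ∀ j, M ≤ j → cookieSeq M p p₀ j = p₀ := fun j hj => dif_neg (by omega)
  have hq := cookieSeq_mem_Ioo hp hp₀'
  generalize cookieSeq M p p₀ = q at hq hqM
  have hpos := bbTrans_pos hq
  have hnonneg : ∀ l m, 0 ≤ bbTrans q l m := fun l m => (hpos l m).le
  set P : ℕ → ℕ → ℝ≥0∞ := fun l m => ENNReal.ofReal (bbTrans q l m)
  have hP : ∀ l, ∑' m, P l m = 1 := tsum_bbTrans hq hqM
  have hPpos : ∀ l m, P l m ≠ 0 := fun l m => (ENNReal.ofReal_pos.2 (hpos l m)).ne'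
  have hr0 : 0 ≤ 1 / p₀ - 1 := sub_nonneg.2 (one_lt_one_div hp₀'.1 hp₀'.2).le
  have hr1 : 1 / p₀ - 1 < 1 := by
    have := (div_lt_iff₀ hp₀'.1).2 (show (1 : ℝ) < 2 * p₀ by linarith [hp₀.1])
    linarith
  obtain ⟨U, hU0, hU⟩ := exists_lyapunov hP (fun l => hPpos l 0) hr0 hr1
    (by positivity : (0 : ℝ) ≤ M + (1 / p₀ - 1)) (tsum_nat_mul_bbTrans_le hq hqM)
  have hμ : ∑' m : ℕ, excursionMeasure P m * ((m : ℝ≥0∞) + 1) ≠ ⊤ :=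
    ne_top_of_le_ne_top hU0 (tsum_excursionMeasure_mul_le hU)
  simp only [mul_add, mul_one] at hμ
  rw [ENNReal.tsum_add, ENNReal.add_ne_top] at hμ
  obtain ⟨hμmean, hμfin⟩ := hμ
  have hsurv : ∑' n, ∑' m, tabooProb P n m ≠ ⊤ := by
    rw [ENNReal.tsum_comm]
    exact hμfin
  have hstep := tsum_tabooProb_eq_succ_add hP
  set f : ℕ → ℝ≥0∞ := fun n => ∑' l, tabooProb P n l * P l 0 with hf
  have hret : ∀ n, returnProb q (n + 1) = (f n).toReal := returnProb_succ hnonneg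
  have hret0 : returnProb q 0 = 0 := dif_pos rfl
  have hf1 : ∑' n, f n = 1 := by
    rw [tsum_eq_of_eq_succ_add hstep hsurv]
    simpa using tsum_tabooProb_zero_mul P fun _ => 1
  have hffin : ∀ n, f n ≠ ⊤ :=
    ENNReal.ne_top_of_tsum_ne_top (by rw [hf1]; exact ENNReal.one_ne_top)
  have hfmean : ∑' n : ℕ, ((n : ℝ≥0∞) + 1) * f n ≠ ⊤ :=
    ne_top_of_le_ne_top hsurv (tsum_mul_le_of_eq_succ_add hstep)
  set c := ∑' m, excursionMeasure P m
  have hc0 : c ≠ 0 := fun h0 => by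
    have h1 := ENNReal.tsum_eq_zero.1 h0 0
    rw [excursionMeasure_zero] at h1
    exact one_ne_zero h1
  set ρ : ℕ → ℝ≥0∞ := fun m => c⁻¹ * excursionMeasure P m with hρ
  have hρ1 : ∑' m, ρ m = 1 := by
    rw [ENNReal.tsum_mul_left]
    exact ENNReal.inv_mul_cancel hc0 hμfin
  have hρinv : ∀ m, ρ m = ∑' l, ρ l * P l m := fun m => by
    simp only [hρ, mul_assoc]
    rw [ENNReal.tsum_mul_left, ← excursionMeasure_invariant hf1]
  have huniq : ∀ π, IsStationaryDist q π → π = fun m => (ρ m).toReal := fun π h => by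
    have heq := invariant_unique hP hPpos h.tsum_ofReal hρ1 (h.ofReal_eq_tsum hnonneg hP) hρinv
    funext m
    rw [← congrFun heq m, ENNReal.toReal_ofReal (h.1 m)]
  refine ⟨⟨?_, ?_⟩, ⟨_, isStationaryDist_toReal hnonneg hρ1 hρinv, huniq⟩, fun π h => ?_⟩
  · have hs : Summable fun n => returnProb q (n + 1) := by
      simp only [hret]
      exact ENNReal.summable_toReal (by rw [hf1]; exact ENNReal.one_ne_top)
    rw [tsum_eq_zero_add' hs, hret0, zero_add]
    simp only [hret]
    rw [← ENNReal.tsum_toReal_eq hffin, hf1, ENNReal.toReal_one]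
  · rw [← summable_nat_add_iff 1]
    refine (ENNReal.summable_toReal hfmean).congr fun n => ?_
    rw [hret, ENNReal.toReal_mul, ENNReal.toReal_add (by simp) (by simp)]
    simp
  · rw [huniq π h]
    have hm : ∑' m, c⁻¹ * (excursionMeasure P m * (m : ℝ≥0∞)) ≠ ⊤ := by
      rw [ENNReal.tsum_mul_left]
      exact ENNReal.mul_ne_top (ENNReal.inv_ne_top.2 hc0) hμmean
    refine (ENNReal.summable_toReal hm).congr fun m => ?_
    rw [← mul_assoc, ENNReal.toReal_mul, ENNReal.toReal_natCast, mul_comm]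
end

section
/- Let 5/6 < q < p < 1 and set f(q) = (6q−5)(q²−2q−1)/(24q⁴−42q³−3q²+28q−9). Suppose the standard excited random walk (Y^q_n)_{n≥0} with cookie vector (q,q,q) satisfies liminf_{n→∞} Y^q_n / n ≥ f(q) almost surely. Then there exist ε > 0 and M ∈ ℕ such that the cookie vector 𝐩 = (p, 1/2+ε, 1/2+ε, …, 1/2+ε) ∈ (0,1)^M has first entry 𝐩_1 = p > q, satisfies δ(M,𝐩) > 2, and the standard excited random walk (Y^𝐩_n)_{n≥0} with cookie vector 𝐩 satisfies, almost surely, limsup_{n→∞} Y^𝐩_n / n < f(q) ≤ liminf_{n→∞} Y^q_n / n. -/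
open MeasureTheory ProbabilityTheory Filter Topology
open scoped ENNReal NNReal

/-- `IsEARW P M p p₀ X` : under the probability measure `P`, the process `X` is an
excited asymmetric random walk with `M` cookies of strengths `p ∈ (0,1)^M` and bias
parameter `p₀`: it starts at `0`, moves by `±1` steps, and conditionally on the path
`(X 0, …, X n)` it steps right with probability `p i` on the event
`#{m ≤ n : X m = X n} = i` for `1 ≤ i ≤ M`, and with probability `p₀` on the event
`#{m ≤ n : X m = X n} > M`. -/
structure IsEARW {Ω : Type*} [MeasurableSpace Ω] (P : Measure Ω)
    (M : ℕ) (p : Fin M → ℝ) (p₀ : ℝ) (X : ℕ → Ω → ℤ) : Prop where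
  measurable : ∀ n, Measurable (X n)
  init : ∀ ω, X 0 ω = 0
  steps : ∀ ω n, |X (n + 1) ω - X n ω| = 1
  cond : ∀ (n : ℕ) (w : Fin (n + 1) → ℤ),
    P ({ω | X (n + 1) ω = w (Fin.last n) + 1} ∩ {ω | ∀ m : Fin (n + 1), X m ω = w m})
      = ENNReal.ofReal
          (cookieSeq M p p₀
            ((Finset.univ.filter fun m : Fin (n + 1) => w m = w (Fin.last n)).card - 1))
        * P {ω | ∀ m : Fin (n + 1), X m ω = w m}


/-- The conditional mean of the step following the path segment `w`. -/
noncomputable def pathDrift (M : ℕ) (p : Fin M → ℝ) (p₀ : ℝ) {n : ℕ} (w : Fin (n + 1) → ℤ) : ℝ :=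
  2 * cookieSeq M p p₀
    ((Finset.univ.filter fun m : Fin (n + 1) => w m = w (Fin.last n)).card - 1) - 1

/-- The position with the accumulated drift removed. -/
noncomputable def compensatedPath (M : ℕ) (p : Fin M → ℝ) (p₀ : ℝ) (x : ℕ → ℤ) (n : ℕ) : ℝ :=
  x n - ∑ k ∈ Finset.range n, pathDrift M p p₀ fun m : Fin (k + 1) => x m

section Martingale

variable {Ω : Type*} [MeasurableSpace Ω] {P : Measure Ω} {M : ℕ} {p : Fin M → ℝ} {p₀ : ℝ}
  {X : ℕ → Ω → ℤ}

lemma compensatedPath_succ (x : ℕ → ℤ) (n : ℕ) :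
    compensatedPath M p p₀ x (n + 1) = compensatedPath M p p₀ x n
      + ((x (n + 1) : ℝ) - x n - pathDrift M p p₀ fun m : Fin (n + 1) => x m) := by
  simp only [compensatedPath, Finset.sum_range_succ]
  ring

lemma abs_pathDrift_le_one (hc : ∀ j, cookieSeq M p p₀ j ∈ Set.Icc (0 : ℝ) 1) {n : ℕ}
    (w : Fin (n + 1) → ℤ) : |pathDrift M p p₀ w| ≤ 1 := by
  have := hc ((Finset.univ.filter fun m : Fin (n + 1) => w m = w (Fin.last n)).card - 1)
  rw [pathDrift, abs_le]
  constructor <;> linarith [this.1, this.2]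

lemma abs_compensatedPath_succ_sub_le (hc : ∀ j, cookieSeq M p p₀ j ∈ Set.Icc (0 : ℝ) 1)
    {x : ℕ → ℤ} (hx : ∀ n, |x (n + 1) - x n| = 1) (n : ℕ) :
    |compensatedPath M p p₀ x (n + 1) - compensatedPath M p p₀ x n| ≤ 2 := by
  rw [compensatedPath_succ, add_sub_cancel_left]
  have h1 : |(x (n + 1) : ℝ) - x n| = 1 := by exact_mod_cast hx n
  have h2 := abs_pathDrift_le_one hc fun m : Fin (n + 1) => x m
  linarith [abs_sub ((x (n + 1) : ℝ) - x n) (pathDrift M p p₀ fun m : Fin (n + 1) => x m)]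

lemma abs_le_of_abs_succ_sub_le {s : ℕ → ℝ} {B : ℝ} (hs : ∀ n, |s (n + 1) - s n| ≤ B) (m n : ℕ) :
    |s (m + n)| ≤ |s m| + B * n := by
  induction n with
  | zero => simp
  | succ n ih =>
    have h1 := hs (m + n)
    have h2 := abs_add_le (s (m + n)) (s (m + n + 1) - s (m + n))
    rw [add_sub_cancel] at h2
    rw [← add_assoc]
    push_cast
    linarith

lemma IsEARW.measurable_comp_path (h : IsEARW P M p p₀ X) (n : ℕ)
    (G : (Fin (n + 1) → ℤ) → ℝ) : Measurable fun ω => G (fun m => X m ω) :=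
  (measurable_of_countable G).comp (measurable_pi_lambda _ fun m => h.measurable m)

lemma IsEARW.measurable_compensatedPath (h : IsEARW P M p p₀ X) (n : ℕ) :
    Measurable fun ω => compensatedPath M p p₀ (fun k => X k ω) n := by
  unfold compensatedPath
  refine ((measurable_of_countable fun z : ℤ => (z : ℝ)).comp (h.measurable n)).sub ?_
  exact Finset.measurable_sum _ fun k _ => h.measurable_comp_path k (pathDrift M p p₀)

lemma IsEARW.abs_compensatedPath_le (h : IsEARW P M p p₀ X)
    (hc : ∀ j, cookieSeq M p p₀ j ∈ Set.Icc (0 : ℝ) 1) (n : ℕ) (ω : Ω) :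
    |compensatedPath M p p₀ (fun k => X k ω) n| ≤ 2 * n := by
  have := abs_le_of_abs_succ_sub_le
    (abs_compensatedPath_succ_sub_le hc (x := fun k => X k ω) (h.steps ω)) 0 n
  simpa [compensatedPath, h.init ω] using this

variable [IsProbabilityMeasure P]

/-- The compensated step is orthogonal to every function of the past. -/
lemma IsEARW.integral_mul_compensated_step (h : IsEARW P M p p₀ X)
    (hc : ∀ j, cookieSeq M p p₀ j ∈ Set.Icc (0 : ℝ) 1) (n : ℕ)
    (G : (Fin (n + 1) → ℤ) → ℝ)
    (hG : Integrable (fun ω => G (fun m => X m ω) * ((X (n + 1) ω : ℝ) - X n ω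
      - pathDrift M p p₀ fun m : Fin (n + 1) => X m ω)) P) :
    ∫ ω, G (fun m => X m ω) * ((X (n + 1) ω : ℝ) - X n ω
      - pathDrift M p p₀ fun m : Fin (n + 1) => X m ω) ∂P = 0 := by
  let A : (Fin (n + 1) → ℤ) → Set Ω := fun w => {ω | ∀ m : Fin (n + 1), X m ω = w m}
  have hA : ∀ w, MeasurableSet (A w) := fun w => by
    simp only [A, Set.ofPred_forall]
    exact MeasurableSet.iInter fun m => h.measurable m (measurableSet_singleton _)
  have hdisj : Pairwise (Function.onFun Disjoint A) := fun v w hvw => by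
    refine Set.disjoint_left.2 fun ω hv hw => hvw ?_
    funext m
    exact (hv m).symm.trans (hw m)
  have hU : (⋃ w, A w) = Set.univ :=
    Set.eq_univ_of_forall fun ω => Set.mem_iUnion.2 ⟨fun m => X m ω, fun _ => rfl⟩
  rw [← setIntegral_univ, ← hU, integral_iUnion hA hdisj hG.integrableOn]
  refine (tsum_congr fun w => ?_).trans tsum_zero
  set c := cookieSeq M p p₀
    ((Finset.univ.filter fun m : Fin (n + 1) => w m = w (Fin.last n)).card - 1) with hcdef
  let U : Set Ω := {ω | X (n + 1) ω = w (Fin.last n) + 1}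
  have hUm : MeasurableSet U := h.measurable (n + 1) (measurableSet_singleton _)
  have hreal : P.real (U ∩ A w) = c * P.real (A w) := by
    have := congrArg ENNReal.toReal (h.cond n w)
    rwa [ENNReal.toReal_mul, ENNReal.toReal_ofReal (hc _).1] at this
  have hcongr : ∀ ω ∈ A w, G (fun m => X m ω) * ((X (n + 1) ω : ℝ) - X n ω
      - pathDrift M p p₀ fun m : Fin (n + 1) => X m ω)
      = 2 * G w * (U.indicator (fun _ => (1 : ℝ)) ω - c) := by
    intro ω hω
    have hpath : (fun m : Fin (n + 1) => X m ω) = w := funext hω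
    have hlast : X n ω = w (Fin.last n) := hω (Fin.last n)
    rw [hpath, pathDrift, ← hcdef]
    have hstep := h.steps ω n
    by_cases hu : ω ∈ U
    · have : X (n + 1) ω = w (Fin.last n) + 1 := hu
      rw [Set.indicator_of_mem hu, this, hlast]
      push_cast
      ring
    · have hne : X (n + 1) ω ≠ w (Fin.last n) + 1 := hu
      have : X (n + 1) ω = w (Fin.last n) - 1 := by
        rcases (abs_eq zero_le_one).1 hstep with h1 | h1 <;> omega
      rw [Set.indicator_of_notMem hu, this, hlast]
      push_cast
      ring
  rw [setIntegral_congr_fun (hA w) hcongr, integral_const_mul, integral_sub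
    ((integrable_const _).indicator hUm) (integrable_const _), integral_indicator_const _ hUm,
    measureReal_restrict_apply hUm, hreal]
  simp [mul_comm]

lemma IsEARW.integral_compensatedPath_sq_le (h : IsEARW P M p p₀ X)
    (hc : ∀ j, cookieSeq M p p₀ j ∈ Set.Icc (0 : ℝ) 1) (n : ℕ) :
    ∫ ω, compensatedPath M p p₀ (fun k => X k ω) n ^ 2 ∂P ≤ 4 * n := by
  induction n with
  | zero => simp [compensatedPath, h.init]
  | succ n ih =>
    let S : Ω → ℝ := fun ω => compensatedPath M p p₀ (fun k => X k ω) n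
    let D : Ω → ℝ := fun ω => (X (n + 1) ω : ℝ) - X n ω
      - pathDrift M p p₀ fun m : Fin (n + 1) => X m ω
    have hSD : ∀ ω, compensatedPath M p p₀ (fun k => X k ω) (n + 1) = S ω + D ω :=
      fun ω => compensatedPath_succ _ _
    have hS : Measurable S := h.measurable_compensatedPath n
    have hD : Measurable D := by
      have : D = fun ω => compensatedPath M p p₀ (fun k => X k ω) (n + 1) - S ω := by
        funext ω
        rw [hSD]
        ring
      rw [this]
      exact (h.measurable_compensatedPath (n + 1)).sub hS
    have hSb : ∀ ω, |S ω| ≤ 2 * n := h.abs_compensatedPath_le hc n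
    have hDb : ∀ ω, |D ω| ≤ 2 := fun ω => by
      have := abs_compensatedPath_succ_sub_le hc (x := fun k => X k ω) (h.steps ω) n
      rwa [hSD, add_sub_cancel_left] at this
    have hSi : Integrable (fun ω => S ω ^ 2) P :=
      Integrable.of_bound (hS.pow_const 2).aestronglyMeasurable ((2 * n) ^ 2)
        (ae_of_all _ fun ω => by
          rw [norm_pow]
          exact pow_le_pow_left₀ (norm_nonneg _) (hSb ω) 2)
    have hDi : Integrable (fun ω => D ω ^ 2) P :=
      Integrable.of_bound (hD.pow_const 2).aestronglyMeasurable (2 ^ 2)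
        (ae_of_all _ fun ω => by
          rw [norm_pow]
          exact pow_le_pow_left₀ (norm_nonneg _) (hDb ω) 2)
    have hSDi : Integrable (fun ω => S ω * D ω) P :=
      Integrable.of_bound (hS.mul hD).aestronglyMeasurable (2 * n * 2)
        (ae_of_all _ fun ω => by
          rw [norm_mul]
          exact mul_le_mul (hSb ω) (hDb ω) (norm_nonneg _) (by positivity))
    have horth : ∫ ω, S ω * D ω ∂P = 0 := by
      let G : (Fin (n + 1) → ℤ) → ℝ := fun w =>
        compensatedPath M p p₀ (fun k => if hk : k < n + 1 then w ⟨k, hk⟩ else 0) n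
      have hG : ∀ ω, G (fun m => X m ω) = S ω := fun ω => by
        simp only [G, S, compensatedPath]
        congr 1
        · simp
        · refine Finset.sum_congr rfl fun k hk => ?_
          congr 1
          funext m
          have := Finset.mem_range.1 hk
          have := m.2
          exact dif_pos (by omega)
      have hSDi' := hSDi
      simp only [← hG] at hSDi' ⊢
      exact h.integral_mul_compensated_step hc n G hSDi'
    have hDle : ∫ ω, D ω ^ 2 ∂P ≤ 4 := by
      calc ∫ ω, D ω ^ 2 ∂P ≤ ∫ _, (4 : ℝ) ∂P :=
            integral_mono hDi (integrable_const _) fun ω => by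
              have := pow_le_pow_left₀ (abs_nonneg _) (hDb ω) 2
              rw [sq_abs] at this
              show D ω ^ 2 ≤ 4
              linarith
        _ = 4 := by simp
    calc ∫ ω, compensatedPath M p p₀ (fun k => X k ω) (n + 1) ^ 2 ∂P
        = ∫ ω, (S ω ^ 2 + 2 * (S ω * D ω) + D ω ^ 2) ∂P := by
          congr 1
          funext ω
          rw [hSD]
          ring
      _ = ∫ ω, S ω ^ 2 ∂P + 2 * ∫ ω, S ω * D ω ∂P + ∫ ω, D ω ^ 2 ∂P := by
          rw [integral_add (f := fun ω => S ω ^ 2 + 2 * (S ω * D ω)) (hSi.add (hSDi.const_mul 2)) hDi,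
            integral_add hSi (hSDi.const_mul 2), integral_const_mul]
      _ ≤ 4 * (n + 1 : ℕ) := by
          rw [horth]
          push_cast
          linarith

end Martingale

section StrongLaw

lemma exists_abs_le_mul_add_of_tendsto_sq {s : ℕ → ℝ} {B : ℝ}
    (hs : ∀ n, |s (n + 1) - s n| ≤ B)
    (hlim : Tendsto (fun k : ℕ => (s (k ^ 2) / (k : ℝ) ^ 2) ^ 2) atTop (𝓝 0))
    {δ : ℝ} (hδ : 0 < δ) : ∃ C, ∀ n : ℕ, |s n| ≤ δ * n + C := by
  have hB : 0 ≤ B := (abs_nonneg _).trans (hs 0)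
  have hev : ∀ᶠ k : ℕ in atTop, |s (k ^ 2)| + 2 * B * k ≤ δ * (k : ℝ) ^ 2 := by
    have h1 := hlim.eventually (gt_mem_nhds (show (0 : ℝ) < (δ / 2) ^ 2 by positivity))
    filter_upwards [h1, eventually_gt_atTop 0, eventually_ge_atTop ⌈4 * B / δ⌉₊] with k hk hk0 hkB
    have hk0' : (0 : ℝ) < k := by exact_mod_cast hk0
    have h2 := abs_lt_of_sq_lt_sq hk (by positivity)
    rw [abs_div, abs_of_pos (pow_pos hk0' 2), div_lt_iff₀ (by positivity)] at h2
    have h3 : 4 * B ≤ k * δ := (div_le_iff₀ hδ).1 (Nat.ceil_le.1 hkB)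
    nlinarith
  obtain ⟨K, hK⟩ := eventually_atTop.1 hev
  refine ⟨|s 0| + B * K ^ 2, fun n => ?_⟩
  by_cases hn : K ≤ Nat.sqrt n
  · have h1 := hK _ hn
    obtain ⟨m, hm⟩ := Nat.exists_eq_add_of_le (Nat.sqrt_le' n)
    have hm2 : m ≤ 2 * Nat.sqrt n := by
      have := Nat.lt_succ_sqrt' n
      rw [Nat.succ_eq_add_one] at this
      nlinarith
    have h2 := abs_le_of_abs_succ_sub_le hs (Nat.sqrt n ^ 2) m
    rw [← hm] at h2
    have h3 : (m : ℝ) ≤ 2 * Nat.sqrt n := by exact_mod_cast hm2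
    have h4 : ((Nat.sqrt n : ℝ)) ^ 2 ≤ n := by exact_mod_cast Nat.sqrt_le' n
    have h5 := mul_le_mul_of_nonneg_left h3 hB
    have h6 := mul_le_mul_of_nonneg_left h4 hδ.le
    have h7 : 0 ≤ |s 0| + B * (K : ℝ) ^ 2 := by positivity
    linarith
  · have h1 := abs_le_of_abs_succ_sub_le hs 0 n
    rw [zero_add] at h1
    have h2 : (n : ℝ) ≤ (K : ℝ) ^ 2 := by exact_mod_cast (Nat.sqrt_lt'.1 (not_le.1 hn)).le
    have h3 := mul_le_mul_of_nonneg_left h2 hB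
    have h4 : 0 ≤ δ * n := by positivity
    linarith

lemma ae_exists_abs_le_mul_add {Ω : Type*} [MeasurableSpace Ω] {P : Measure Ω}
    {S : ℕ → Ω → ℝ} {A B : ℝ} (hS : ∀ n, Measurable (S n))
    (hstep : ∀ ω n, |S (n + 1) ω - S n ω| ≤ B)
    (hint : ∀ n, Integrable (fun ω => S n ω ^ 2) P)
    (hsq : ∀ n : ℕ, ∫ ω, S n ω ^ 2 ∂P ≤ A * n) {δ : ℝ} (hδ : 0 < δ) :
    ∀ᵐ ω ∂P, ∃ C, ∀ n : ℕ, |S n ω| ≤ δ * n + C := by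
  let g : ℕ → Ω → ℝ≥0∞ := fun k ω => ENNReal.ofReal ((S (k ^ 2) ω / (k : ℝ) ^ 2) ^ 2)
  have hg : ∀ k, Measurable (g k) := fun k =>
    (((hS _).div_const _).pow_const 2).ennreal_ofReal
  have hgle : ∀ k, ∫⁻ ω, g k ω ∂P ≤ ENNReal.ofReal (A * (1 / (k : ℝ) ^ 2)) := fun k => by
    have hi : Integrable (fun ω => (S (k ^ 2) ω / (k : ℝ) ^ 2) ^ 2) P := by
      simp_rw [div_pow]
      exact (hint _).div_const _
    rw [← ofReal_integral_eq_lintegral_ofReal hi (ae_of_all _ fun ω => sq_nonneg _)]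
    apply ENNReal.ofReal_le_ofReal
    simp_rw [div_pow]
    rw [integral_div]
    rcases Nat.eq_zero_or_pos k with rfl | hk
    · simp
    · have hk' : (0 : ℝ) < k := by exact_mod_cast hk
      rw [div_le_iff₀ (by positivity)]
      refine (hsq (k ^ 2)).trans (le_of_eq ?_)
      push_cast
      field_simp
  have hsum : ∫⁻ ω, ∑' k, g k ω ∂P ≠ ∞ := by
    rw [lintegral_tsum fun k => (hg k).aemeasurable]
    exact ne_top_of_le_ne_top
      ((Real.summable_one_div_nat_pow.2 one_lt_two).mul_left A).tsum_ofReal_ne_top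
      (ENNReal.tsum_le_tsum hgle)
  filter_upwards [ae_lt_top (Measurable.tsum hg) hsum] with ω hω
  refine exists_abs_le_mul_add_of_tendsto_sq (hstep ω) ?_ hδ
  have h0 := ENNReal.tendsto_atTop_zero_of_tsum_ne_top hω.ne
  have h1 := (ENNReal.tendsto_toReal ENNReal.zero_ne_top).comp h0
  simpa [Function.comp_def, g, ENNReal.toReal_ofReal, sq_nonneg] using h1

end StrongLaw

section Range

lemma sum_le_mul_card_image_add {α : Type*} [DecidableEq α] {x : ℕ → α} {d : ℕ → ℝ} {a b : ℝ}
    (hd : ∀ k, d k ≤ a + b)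
    (hrep : ∀ k, (∃ j < k, x j = x k) → d k ≤ b) (n : ℕ) :
    ∑ k ∈ Finset.range n, d k ≤ a * ((Finset.range n).image x).card + b * n := by
  induction n with
  | zero => simp
  | succ n ih =>
    rw [Finset.sum_range_succ, Finset.range_add_one, Finset.image_insert]
    by_cases hn : x n ∈ (Finset.range n).image x
    · rw [Finset.insert_eq_of_mem hn]
      obtain ⟨j, hj, hjn⟩ := Finset.mem_image.1 hn
      have := hrep n ⟨j, Finset.mem_range.1 hj, hjn⟩
      push_cast
      linarith
    · rw [Finset.card_insert_of_notMem hn]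
      have := hd n
      push_cast
      linarith

lemma card_image_le_of_mem_Icc {ι : Type*} {s : Finset ι} {x : ι → ℤ} {l u : ℝ} (hlu : l ≤ u)
    (hx : ∀ i ∈ s, (x i : ℝ) ∈ Set.Icc l u) : ((s.image x).card : ℝ) ≤ u - l + 1 := by
  have hsub : s.image x ⊆ Finset.Icc ⌈l⌉ ⌊u⌋ := by
    intro z hz
    obtain ⟨i, hi, rfl⟩ := Finset.mem_image.1 hz
    exact Finset.mem_Icc.2 ⟨Int.ceil_le.2 (hx i hi).1, Int.le_floor.2 (hx i hi).2⟩
  have h1 := Finset.card_le_card hsub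
  rw [Int.card_Icc] at h1
  have h2 : (((s.image x).card : ℤ)) ≤ max (⌊u⌋ + 1 - ⌈l⌉) 0 := by
    rw [← Int.toNat_eq_max]
    exact_mod_cast h1
  have h3 : ((s.image x).card : ℝ) ≤ max ((⌊u⌋ : ℝ) + 1 - ⌈l⌉) 0 := by exact_mod_cast h2
  refine h3.trans (max_le ?_ (by linarith))
  linarith [Int.floor_le u, Int.le_ceil l]

/-- If a sequence has a compensator which is nonnegative, at most `a + b` per step, and at most `b`
at sites seen before, and if the compensated sequence grows at rate at most `δ`, then
the sequence grows at rate at most `δ + b + a * (2 * δ + b) / (1 - a)`. -/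
lemma exists_le_mul_add_of_compensator {x : ℕ → ℤ} {d : ℕ → ℝ} {a b δ C : ℝ}
    (ha : 0 ≤ a) (ha1 : a < 1) (hb : 0 ≤ b) (hδ : 0 ≤ δ) (hd0 : ∀ k, 0 ≤ d k)
    (hd : ∀ k, d k ≤ a + b) (hrep : ∀ k, (∃ j < k, x j = x k) → d k ≤ b)
    (hC : ∀ n : ℕ, |(x n : ℝ) - ∑ k ∈ Finset.range n, d k| ≤ δ * n + C) :
    ∃ C', ∀ n : ℕ, (x n : ℝ) ≤ (δ + b + a * ((2 * δ + b) / (1 - a))) * n + C' := by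
  have hC0 : 0 ≤ C := by simpa using (abs_nonneg _).trans (hC 0)
  have ha1' : 0 < 1 - a := by linarith
  refine ⟨C + a * ((2 * C + 1) / (1 - a)), fun n => ?_⟩
  set R : ℝ := (((Finset.range n).image x).card : ℝ) with hR
  have hR0 : 0 ≤ R := by positivity
  have hsum := sum_le_mul_card_image_add hd hrep n
  rw [← hR] at hsum
  have hn : (0 : ℝ) ≤ n := Nat.cast_nonneg n
  have hrange : R ≤ (δ * n + C + a * R + b * n) - (-(δ * n + C)) + 1 := by
    refine card_image_le_of_mem_Icc ?_ fun k hk => ?_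
    · have := mul_nonneg hδ hn
      have := mul_nonneg hb hn
      have := mul_nonneg ha hR0
      linarith
    · have hk' : k ≤ n := (Finset.mem_range.1 hk).le
      have hkn : (k : ℝ) ≤ n := by exact_mod_cast hk'
      have h1 := abs_le.1 (hC k)
      have h2 : 0 ≤ ∑ j ∈ Finset.range k, d j := Finset.sum_nonneg fun j _ => hd0 j
      have h3 : ∑ j ∈ Finset.range k, d j ≤ ∑ j ∈ Finset.range n, d j :=
        Finset.sum_le_sum_of_subset_of_nonneg (Finset.range_mono hk') fun j _ _ => hd0 j
      have h4 := mul_le_mul_of_nonneg_left hkn hδ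
      constructor <;> linarith [h1.1, h1.2]
  have hRle : R ≤ ((2 * δ + b) * n + (2 * C + 1)) / (1 - a) := by
    rw [le_div_iff₀ ha1']
    linarith
  have h5 := mul_le_mul_of_nonneg_left hRle ha
  have h6 := (abs_le.1 (hC n)).2
  calc (x n : ℝ) ≤ δ * n + C + (a * (((2 * δ + b) * n + (2 * C + 1)) / (1 - a)) + b * n) := by
        linarith
    _ = _ := by ring

end Range

lemma limsup_div_le_of_le_mul_add {x : ℕ → ℝ} {v C v' : ℝ} (hx : ∀ n : ℕ, x n ≤ v * n + C)
    (hlow : ∀ n : ℕ, -(n : ℝ) ≤ x n) (hv : v < v') :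
    limsup (fun n : ℕ => x n / n) atTop ≤ v' := by
  refine limsup_le_of_le (IsCoboundedUnder.of_frequently_ge (a := -1) ?_) ?_
  · refine Eventually.frequently ?_
    filter_upwards [eventually_gt_atTop 0] with n hn
    have hn' : (0 : ℝ) < n := by exact_mod_cast hn
    rw [le_div_iff₀ hn']
    linarith [hlow n]
  · filter_upwards [eventually_gt_atTop 0, eventually_ge_atTop ⌈C / (v' - v)⌉₊] with n hn hnC
    have hn' : (0 : ℝ) < n := by exact_mod_cast hn
    have h1 := (div_le_iff₀ (sub_pos.2 hv)).1 (Nat.ceil_le.1 hnC)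
    rw [div_le_iff₀ hn']
    linarith [hx n]

/-- Upper bound on the speed of a right-biased excited random walk, uniform in the number of
cookies, when all cookies but the first have strength at most `1 / 2 + ε`. -/
lemma IsEARW.ae_limsup_div_le {Ω : Type*} [MeasurableSpace Ω] {P : Measure Ω}
    [IsProbabilityMeasure P] {M : ℕ} {p : Fin M → ℝ} {p₀ : ℝ} {X : ℕ → Ω → ℤ}
    (h : IsEARW P M p p₀ X) {r ε v : ℝ} (hr : 1 / 2 ≤ r) (hr1 : r < 1) (hε : 0 < ε)
    (hc : ∀ j, cookieSeq M p p₀ j ∈ Set.Icc (1 / 2 : ℝ) 1)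
    (hc0 : cookieSeq M p p₀ 0 ≤ r + ε)
    (hc1 : ∀ j, 1 ≤ j → cookieSeq M p p₀ j ≤ 1 / 2 + ε) (hv : (1 + r) * ε / (1 - r) < v) :
    ∀ᵐ ω ∂P, limsup (fun n : ℕ => (X n ω : ℝ) / n) atTop ≤ v := by
  have hc' : ∀ j, cookieSeq M p p₀ j ∈ Set.Icc (0 : ℝ) 1 := fun j =>
    ⟨by linarith [(hc j).1], (hc j).2⟩
  have hlaw := ae_exists_abs_le_mul_add (P := P) (B := 2) (A := 4) h.measurable_compensatedPath
    (fun ω => abs_compensatedPath_succ_sub_le hc' (h.steps ω))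
    (fun n => Integrable.of_bound
      ((h.measurable_compensatedPath n).pow_const 2).aestronglyMeasurable ((2 * n) ^ 2) (ae_of_all _ fun ω => by
        rw [norm_pow]
        exact pow_le_pow_left₀ (norm_nonneg _) (h.abs_compensatedPath_le hc' n ω) 2))
    (h.integral_compensatedPath_sq_le hc') hε
  filter_upwards [hlaw] with ω ⟨C, hC⟩
  have hd : ∀ k j, cookieSeq M p p₀ (k - j) ≤ r + ε := fun k j => by
    rcases Nat.eq_zero_or_pos (k - j) with h0 | h0
    · rwa [h0]
    · linarith [hc1 _ h0]
  obtain ⟨C', hC'⟩ := exists_le_mul_add_of_compensator (x := fun n => X n ω)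
    (d := fun k => pathDrift M p p₀ fun m : Fin (k + 1) => X m ω) (a := 2 * r - 1) (b := 2 * ε)
    (by linarith) (by linarith) (by linarith) hε.le
    (fun k => by
      rw [pathDrift]
      linarith [(hc ((Finset.univ.filter fun m : Fin (k + 1) =>
        X m ω = X (Fin.last k : Fin (k + 1)) ω).card - 1)).1])
    (fun k => by
      rw [pathDrift]
      linarith [hd ((Finset.univ.filter fun m : Fin (k + 1) =>
        X m ω = X (Fin.last k : Fin (k + 1)) ω).card) 1])
    (fun k ⟨j, hjk, hj⟩ => by
      have hcard : 1 < (Finset.univ.filter fun m : Fin (k + 1) =>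
          X m ω = X (Fin.last k : Fin (k + 1)) ω).card := by
        refine Finset.one_lt_card.2 ⟨⟨j, by omega⟩, by simpa using hj, Fin.last k, by simp, ?_⟩
        intro he
        have := congrArg Fin.val he
        simp at this
        omega
      have := hc1 ((Finset.univ.filter fun m : Fin (k + 1) =>
        X m ω = X (Fin.last k : Fin (k + 1)) ω).card - 1) (by omega)
      rw [pathDrift]
      linarith)
    hC
  refine limsup_div_le_of_le_mul_add hC' (fun n => ?_) (lt_of_le_of_lt (le_of_eq ?_) hv)
  · have := abs_le_of_abs_succ_sub_le (s := fun n => (X n ω : ℝ)) (B := 1)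
      (fun n => by exact_mod_cast (h.steps ω n).le) 0 n
    simp only [h.init, zero_add, Int.cast_zero, abs_zero, one_mul] at this
    exact (abs_le.1 this).1
  · have : 1 - r ≠ 0 := by linarith
    have : 1 - (2 * r - 1) ≠ 0 := by
      intro h0
      linarith
    have h2 : 1 - (2 * r - 1) = 2 * (1 - r) := by ring
    rw [h2]
    field_simp
    ring

lemma three_cookie_speed_bound_pos {q : ℝ} (hq : 5 / 6 < q) (hq1 : q < 1) :
    0 < ((6 * q - 5) * (q ^ 2 - 2 * q - 1))
      / (24 * q ^ 4 - 42 * q ^ 3 - 3 * q ^ 2 + 28 * q - 9) := by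
  apply div_pos_of_neg_of_neg
  · exact mul_neg_of_pos_of_neg (by linarith) (by nlinarith)
  · nlinarith [mul_pos (sub_pos.2 hq) (sub_pos.2 hq1), sq_nonneg (q - 1),
      mul_pos (mul_pos (sub_pos.2 hq) (sub_pos.2 hq1)) (sub_pos.2 hq),
      sq_nonneg (q ^ 2 - 7 / 8 * q)]

/-- **Opposite relations between the first cookie and the speed.**
Let `5/6 < q < p < 1` and let `f q` be the lower bound on the speed of the 3-cookie
walk with cookie vector `(q,q,q)`; suppose that walk satisfies
`liminf Y^q n / n ≥ f q` a.s.  Then there are `ε > 0` and `M` such that the cookie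
vector `𝐩 = (p, 1/2+ε, …, 1/2+ε) ∈ (0,1)^M` has first entry `p > q`, `δ(M,𝐩) > 2`,
and any standard excited random walk with cookie vector `𝐩` satisfies, almost surely,
`limsup Y^𝐩 n / n < f q ≤ liminf Y^q n / n`. -/
theorem first_cookie_speed_opposite_relation
    {Ωq : Type*} [MeasurableSpace Ωq] (Pq : Measure Ωq) [IsProbabilityMeasure Pq]
    (q p : ℝ) (hq : 5 / 6 < q) (hqp : q < p) (hp : p < 1)
    (f : ℝ → ℝ)
    (hf : f = fun x => ((6 * x - 5) * (x ^ 2 - 2 * x - 1))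
      / (24 * x ^ 4 - 42 * x ^ 3 - 3 * x ^ 2 + 28 * x - 9))
    (Yq : ℕ → Ωq → ℤ) (hYq : IsEARW Pq 3 (fun _ => q) (1 / 2) Yq)
    (hlb : ∀ᵐ ω ∂Pq, f q ≤ Filter.liminf (fun n : ℕ => (Yq n ω : ℝ) / n) atTop) :
    ∃ ε : ℝ, 0 < ε ∧ ∃ M : ℕ, 1 ≤ M ∧ ∃ pv : Fin M → ℝ,
      (∀ i : Fin M, pv i = if (i : ℕ) = 0 then p else 1 / 2 + ε)
      ∧ (∀ i, pv i ∈ Set.Ioo (0 : ℝ) 1)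
      ∧ q < p
      ∧ 2 < ∑ i, (2 * pv i - 1)
      ∧ (∀ (Ω : Type) [MeasurableSpace Ω] (P : Measure Ω) [IsProbabilityMeasure P]
          (Y : ℕ → Ω → ℤ), IsEARW P M pv (1 / 2) Y →
          ∀ᵐ ω ∂P, Filter.limsup (fun n : ℕ => (Y n ω : ℝ) / n) atTop < f q)
      ∧ (∀ᵐ ω ∂Pq, f q ≤ Filter.liminf (fun n : ℕ => (Yq n ω : ℝ) / n) atTop) := by
  have hc : 0 < f q := by
    rw [hf]
    exact three_cookie_speed_bound_pos hq (hqp.trans hp)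
  set ε : ℝ := min (1 / 4) ((1 - p) * f q / 8) with hεdef
  have hε : 0 < ε := lt_min (by norm_num) (by have := sub_pos.2 hp; positivity)
  have hε4 : ε ≤ 1 / 4 := min_le_left _ _
  have hεf : ε ≤ (1 - p) * f q / 8 := min_le_right _ _
  obtain ⟨N, hN⟩ := exists_nat_gt (2 / (2 * ε))
  let pv : Fin (N + 1) → ℝ := fun i => if (i : ℕ) = 0 then p else 1 / 2 + ε
  have hpv : ∀ i, pv i ∈ Set.Ico (1 / 2 : ℝ) 1 := fun i => by
    simp only [pv]
    split_ifs <;> constructor <;> linarith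
  refine ⟨ε, hε, N + 1, by omega, pv, fun _ => rfl,
    fun i => ⟨by linarith [(hpv i).1], (hpv i).2⟩, hqp, ?_, ?_, hlb⟩
  · rw [div_lt_iff₀ (by positivity)] at hN
    rw [Fin.sum_univ_succ]
    simp only [pv, Fin.val_zero, Fin.val_succ, if_true, Nat.add_eq_zero_iff, one_ne_zero, and_false,
      if_false, Finset.sum_const, Finset.card_univ, Fintype.card_fin, nsmul_eq_mul]
    linarith
  · intro Ω _ P _ Y hY
    have hcs : ∀ j, cookieSeq (N + 1) pv (1 / 2) j ∈ Set.Icc (1 / 2 : ℝ) 1 := fun j => by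
      unfold cookieSeq
      split_ifs
      · exact Set.Ico_subset_Icc_self (hpv _)
      · constructor <;> norm_num
    have hlim := hY.ae_limsup_div_le (r := p) (v := f q / 2) (by linarith) hp hε hcs
      (by simp [cookieSeq, pv, hε.le])
      (fun j hj => by
        unfold cookieSeq
        split_ifs
        · simp [pv, Nat.one_le_iff_ne_zero.1 hj]
        · linarith)
      (by
        have := sub_pos.2 hp
        rw [div_lt_iff₀ this]
        nlinarith [mul_pos this hc])
    filter_upwards [hlim] with ω hω
    linarith
end
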